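/- Let p ≥ 1, R > 0, 0 < L ≤ R and C ≥ 1 be real numbers. Let v : ℝ → ℝ be a measurable function with v(0) = 1, v(s) > 0 for all s ∈ [0, L], and v(t) ≤ C·v(s) whenever 0 ≤ s ≤ t ≤ L. Let f, f' : ℝ → ℝ be such that f' is integrable on [0, L] and f(t) = f(0) + ∫₀ᵗ f'(s) ds for every t ∈ [0, L]. Then (with both integrals understood as Lebesgue integrals of nonnegative measurable functions, with values in [0, ∞]) ∫₀^L |f(t)|ᵖ·v(t) dt ≤ 2^{p−1}·C·R·|f(0)|ᵖ + 2^{p−1}·C·Rᵖ·∫₀^L |f'(s)|ᵖ·v(s) ds. -/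

import Mathlib

open MeasureTheory

/-- Jensen's inequality for `x ↦ x ^ p`, in the form given by Hölder's inequality. -/
theorem lintegral_enorm_rpow_le_measure_univ_rpow_mul {α E : Type*} [MeasurableSpace α]
    [NormedAddCommGroup E] {μ : Measure α} {g : α → E} {p : ℝ} (hp : 1 ≤ p)
    (hg : AEStronglyMeasurable g μ) :
    (∫⁻ x, ‖g x‖ₑ ∂μ) ^ p ≤ μ Set.univ ^ (p - 1) * ∫⁻ x, ‖g x‖ₑ ^ p ∂μ := by
  have hp0 : 0 < p := by linarith
  have h := eLpNorm'_le_eLpNorm'_mul_rpow_measure_univ one_pos hp hg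
  simp only [eLpNorm', ENNReal.rpow_one, div_one] at h
  refine (ENNReal.rpow_le_rpow h hp0.le).trans_eq ?_
  rw [ENNReal.mul_rpow_of_nonneg _ _ hp0.le, ← ENNReal.rpow_mul, ← ENNReal.rpow_mul,
    one_div_mul_cancel hp0.ne', ENNReal.rpow_one, mul_comm]
  congr 2
  field_simp

theorem ofReal_abs_rpow_mul (x w : ℝ) {p : ℝ} (hp : 0 ≤ p) :
    ENNReal.ofReal (|x| ^ p * w) = ‖x‖ₑ ^ p * ENNReal.ofReal w := by
  rw [ENNReal.ofReal_mul (by positivity), ← ENNReal.ofReal_rpow_of_nonneg (abs_nonneg x) hp,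
    Real.enorm_eq_ofReal_abs]

/-- **Weighted one-dimensional Poincaré inequality** (key estimate in the proof of the
Poincaré inequality for product metrics near the boundary). The weight `v` is the volume
distortion of the normal exponential map, normalized by `v 0 = 1` and satisfying the
Heintze–Karcher bound `v t ≤ C · v s` for `0 ≤ s ≤ t ≤ L`. -/
theorem weighted_one_dim_poincare
    (p R L C : ℝ) (hp : 1 ≤ p) (hR : 0 < R) (hL : 0 < L) (hLR : L ≤ R) (hC : 1 ≤ C)
    (v : ℝ → ℝ) (hv_meas : Measurable v) (hv0 : v 0 = 1)
    (hv_pos : ∀ s ∈ Set.Icc (0 : ℝ) L, 0 < v s)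
    (hv_ratio : ∀ s t : ℝ, 0 ≤ s → s ≤ t → t ≤ L → v t ≤ C * v s)
    (f f' : ℝ → ℝ) (hf' : IntegrableOn f' (Set.Icc (0 : ℝ) L))
    (hf : ∀ t ∈ Set.Icc (0 : ℝ) L, f t = f 0 + ∫ s in (0 : ℝ)..t, f' s) :
    ∫⁻ t in Set.Icc (0 : ℝ) L, ENNReal.ofReal (|f t| ^ p * v t)
      ≤ ENNReal.ofReal (2 ^ (p - 1) * C * R * |f 0| ^ p)
        + ENNReal.ofReal (2 ^ (p - 1) * C * R ^ p)
          * ∫⁻ s in Set.Icc (0 : ℝ) L, ENNReal.ofReal (|f' s| ^ p * v s) := by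
  have hp0 : 0 ≤ p := by linarith
  have hC0 : 0 ≤ C := by linarith
  simp only [ofReal_abs_rpow_mul _ _ hp0]
  set I : ENNReal := ∫⁻ s in Set.Icc (0 : ℝ) L, ‖f' s‖ₑ ^ p * ENNReal.ofReal (v s)
  have pointwise : ∀ t ∈ Set.Icc (0 : ℝ) L, ‖f t‖ₑ ^ p * ENNReal.ofReal (v t) ≤
      2 ^ (p - 1) * (ENNReal.ofReal C * ‖f 0‖ₑ ^ p +
        ENNReal.ofReal R ^ (p - 1) * (ENNReal.ofReal C * I)) := by
    intro t ht
    have hsub : Set.Icc 0 t ⊆ Set.Icc 0 L := Set.Icc_subset_Icc_right ht.2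
    have hf_le : ‖f t‖ₑ ≤ ‖f 0‖ₑ + ∫⁻ s in Set.Icc 0 t, ‖f' s‖ₑ := by
      rw [hf t ht, intervalIntegral.integral_of_le ht.1, ← integral_Icc_eq_integral_Ioc]
      exact (enorm_add_le _ _).trans (by gcongr; exact enorm_integral_le_lintegral_enorm _)
    have holder : (∫⁻ s in Set.Icc 0 t, ‖f' s‖ₑ) ^ p ≤
        ENNReal.ofReal R ^ (p - 1) * ∫⁻ s in Set.Icc 0 t, ‖f' s‖ₑ ^ p := by
      refine (lintegral_enorm_rpow_le_measure_univ_rpow_mul hp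
        (hf'.mono_set hsub).aestronglyMeasurable).trans ?_
      rw [Measure.restrict_apply_univ, Real.volume_Icc]
      gcongr
      linarith [ht.2]
    have weight : (∫⁻ s in Set.Icc 0 t, ‖f' s‖ₑ ^ p) * ENNReal.ofReal (v t) ≤
        ENNReal.ofReal C * I := by
      rw [← lintegral_mul_const' _ _ ENNReal.ofReal_ne_top,
        ← lintegral_const_mul' _ _ ENNReal.ofReal_ne_top]
      refine (setLIntegral_mono' measurableSet_Icc fun s hs => ?_).trans
        (lintegral_mono_set hsub)
      rw [mul_left_comm, ← ENNReal.ofReal_mul hC0]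
      gcongr
      exact hv_ratio s t hs.1 hs.2 ht.2
    have weight_zero : v t ≤ C := by simpa [hv0] using hv_ratio 0 t le_rfl ht.1 ht.2
    calc ‖f t‖ₑ ^ p * ENNReal.ofReal (v t)
        ≤ (‖f 0‖ₑ + ∫⁻ s in Set.Icc 0 t, ‖f' s‖ₑ) ^ p * ENNReal.ofReal (v t) := by gcongr
      _ ≤ 2 ^ (p - 1) * (‖f 0‖ₑ ^ p + (∫⁻ s in Set.Icc 0 t, ‖f' s‖ₑ) ^ p) *
          ENNReal.ofReal (v t) := by
        gcongr
        exact ENNReal.rpow_add_le_mul_rpow_add_rpow _ _ hp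
      _ ≤ 2 ^ (p - 1) * (‖f 0‖ₑ ^ p + ENNReal.ofReal R ^ (p - 1) *
          ∫⁻ s in Set.Icc 0 t, ‖f' s‖ₑ ^ p) * ENNReal.ofReal (v t) := by gcongr
      _ = 2 ^ (p - 1) * (ENNReal.ofReal (v t) * ‖f 0‖ₑ ^ p + ENNReal.ofReal R ^ (p - 1) *
          ((∫⁻ s in Set.Icc 0 t, ‖f' s‖ₑ ^ p) * ENNReal.ofReal (v t))) := by ring
      _ ≤ _ := by gcongr
  have rpow_R : ENNReal.ofReal (R ^ p) = ENNReal.ofReal R ^ (p - 1) * ENNReal.ofReal R := by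
    rw [ENNReal.ofReal_rpow_of_pos hR, ← ENNReal.ofReal_mul (by positivity),
      ← Real.rpow_add_one hR.ne', sub_add_cancel]
  have ofReal_two_C : ENNReal.ofReal (2 ^ (p - 1) * C) = 2 ^ (p - 1) * ENNReal.ofReal C := by
    rw [ENNReal.ofReal_mul (by positivity), ← ENNReal.ofReal_rpow_of_pos two_pos,
      ENNReal.ofReal_ofNat]
  refine (setLIntegral_mono' measurableSet_Icc pointwise).trans ?_
  rw [setLIntegral_const, Real.volume_Icc, sub_zero]
  grw [hLR]
  rw [mul_comm _ (|f 0| ^ p), ofReal_abs_rpow_mul _ _ hp0,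
    ENNReal.ofReal_mul (q := R) (by positivity), ENNReal.ofReal_mul (q := R ^ p) (by positivity),
    rpow_R, ofReal_two_C]
  exact le_of_eq (by ring)
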